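/- arXiv:1605.01506 — 2 statements merged into one kernel-verified Lean document; each statement's English description precedes it below -/
import Mathlib

section
/- If n ≥ 1 and A ⊆ (ℤ/4ℤ)^n is progression-free, then |A| ≤ 4^(γn), where γ = sup{ (1/2)(H(1/2 − ε) + H(2ε)) : 0 < ε < 1/4 } ≈ 0.926. -/
/-- A set `A` in an additively written abelian group is progression-free if there do not
exist pairwise distinct `a, b, c ∈ A` with `a + b = 2c`. -/
def ProgressionFree {G : Type*} [AddCommGroup G] (A : Set G) : Prop :=
  ¬ ∃ a ∈ A, ∃ b ∈ A, ∃ c ∈ A, a ≠ b ∧ a ≠ c ∧ b ≠ c ∧ a + b = c + c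

/-- The binary entropy function `H(x) = -x log₂ x - (1-x) log₂ (1-x)`. -/
noncomputable def binEnt (x : ℝ) : ℝ :=
  -x * Real.logb 2 x - (1 - x) * Real.logb 2 (1 - x)

/-- `γ = sup { (1/2)(H(1/2-ε) + H(2ε)) : 0 < ε < 1/4 } ≈ 0.926`. -/
noncomputable def gam : ℝ :=
  sSup ((fun ε : ℝ => (1 / 2) * (binEnt (1 / 2 - ε) + binEnt (2 * ε))) ''
    Set.Ioo 0 (1 / 4))

open Finset

section Entropy

lemma binEnt_eq (x : ℝ) : binEnt x = Real.binEntropy x / Real.log 2 := by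
  rw [Real.binEntropy_eq_negMulLog_add_negMulLog_one_sub, binEnt, Real.negMulLog, Real.negMulLog,
    Real.logb, Real.logb]
  ring

lemma continuous_binEnt : Continuous binEnt := by
  rw [show binEnt = fun x => Real.binEntropy x / Real.log 2 from funext binEnt_eq]
  exact Real.binEntropy_continuous.div_const _

lemma half_binEnt_add_le_gam {ε : ℝ} (h : ε ∈ Set.Icc (0 : ℝ) (1 / 4)) :
    (1 / 2) * (binEnt (1 / 2 - ε) + binEnt (2 * ε)) ≤ gam := by
  set f := fun ε : ℝ => (1 / 2) * (binEnt (1 / 2 - ε) + binEnt (2 * ε)) with hf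
  have hc : Continuous f := by
    have := continuous_binEnt
    fun_prop
  have hbdd : BddAbove (f '' Set.Ioo 0 (1 / 4)) :=
    (isCompact_Icc.bddAbove_image hc.continuousOn).mono
      (Set.image_mono (Set.Ioo_subset_Icc_self : Set.Ioo (0 : ℝ) (1 / 4) ⊆ _))
  have hcl : IsClosed {x | f x ≤ gam} := isClosed_le hc continuous_const
  have hsub : Set.Ioo (0 : ℝ) (1 / 4) ⊆ {x | f x ≤ gam} :=
    fun x hx => le_csSup hbdd ⟨x, hx, rfl⟩
  have := closure_minimal hsub hcl
  rw [closure_Ioo (by norm_num)] at this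
  exact this h

/-- The entropy bound for the volume of a Hamming ball. -/
lemma card_filter_card_le_two_rpow {ι : Type*} [Fintype ι] [DecidableEq ι] {p : ℝ}
    (hp0 : 0 ≤ p) (hp : p ≤ 1 / 2) {m : ℕ} (hm : (m : ℝ) ≤ p * Fintype.card ι) :
    (#{S : Finset ι | #S ≤ m} : ℝ) ≤ (2 : ℝ) ^ (Fintype.card ι * binEnt p) := by
  have h2 : 0 < Real.log 2 := Real.log_pos (by norm_num)
  set N := Fintype.card ι with hN
  rcases hp0.eq_or_lt with rfl | hp0
  · have hm0 : m = 0 := by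
      have : (m : ℝ) ≤ 0 := by simpa using hm
      exact_mod_cast le_antisymm this (Nat.cast_nonneg m)
    subst hm0
    have : ({S : Finset ι | #S ≤ 0} : Finset (Finset ι)) = {∅} := by
      ext S; simp
    rw [this]
    simp [binEnt]
  have hq : 0 < 1 - p := by linarith
  have hterm : ∀ S ∈ ({S : Finset ι | #S ≤ m} : Finset (Finset ι)),
      (2 : ℝ) ^ (-(N * binEnt p)) ≤ p ^ #S * (1 - p) ^ (N - #S) := by
    intro S hS
    have hS : #S ≤ m := by simpa using hS
    have hSN : #S ≤ N := card_le_univ S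
    have hlog : Real.log p ≤ Real.log (1 - p) := Real.log_le_log hp0 (by linarith)
    have hSp : (#S : ℝ) ≤ p * N := le_trans (by exact_mod_cast hS) hm
    rw [← Real.exp_log (show 0 < p ^ #S * (1 - p) ^ (N - #S) by positivity),
      Real.rpow_def_of_pos (by norm_num), Real.exp_le_exp,
      Real.log_mul (by positivity) (by positivity), Real.log_pow, Real.log_pow,
      binEnt_eq, Nat.cast_sub hSN, Real.binEntropy_eq_negMulLog_add_negMulLog_one_sub,
      Real.negMulLog, Real.negMulLog]
    have : Real.log 2 * -(N * ((-p * Real.log p + -(1 - p) * Real.log (1 - p)) / Real.log 2))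
        = N * (p * Real.log p + (1 - p) * Real.log (1 - p)) := by
      field_simp
      ring
    rw [this]
    nlinarith [mul_nonneg (sub_nonneg.2 hSp) (sub_nonneg.2 hlog)]
  have hsum : ∑ S : Finset ι, p ^ #S * (1 - p) ^ (N - #S) = 1 := by
    have := Finset.sum_pow_mul_eq_add_pow p (1 - p) (univ : Finset ι)
    simpa using this
  have hle : (#{S : Finset ι | #S ≤ m} : ℝ) * (2 : ℝ) ^ (-(N * binEnt p)) ≤ 1 := by
    rw [← nsmul_eq_mul, ← hsum]
    refine (card_nsmul_le_sum _ _ _ hterm).trans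
      (sum_le_sum_of_subset_of_nonneg (subset_univ _) fun S _ _ => by positivity)
  rw [Real.rpow_neg (by norm_num)] at hle
  rwa [← div_eq_mul_inv, div_le_one (by positivity)] at hle

lemma card_mul_card_le_rpow_gam {ι : Type*} [Fintype ι] [DecidableEq ι] [Nonempty ι] {d : ℕ}
    (hd : d ≤ Fintype.card ι) :
    (#{S : Finset ι | #S ≤ d / 2} : ℝ) * #{S : Finset ι | #S ≤ Fintype.card ι - d}
      ≤ (4 : ℝ) ^ (gam * Fintype.card ι) := by
  have hN : (0 : ℝ) < Fintype.card ι := by exact_mod_cast Fintype.card_pos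
  set N := Fintype.card ι with hNdef
  have hdN : (d : ℝ) ≤ N := by exact_mod_cast hd
  have hd2 : ((d / 2 : ℕ) : ℝ) ≤ d / 2 := Nat.cast_div_le
  have key : ∀ ε ∈ Set.Icc (0 : ℝ) (1 / 4),
      (2 : ℝ) ^ (N * binEnt (1 / 2 - ε)) * (2 : ℝ) ^ (N * binEnt (2 * ε)) ≤
        (4 : ℝ) ^ (gam * N) := by
    intro ε hε
    have h := half_binEnt_add_le_gam hε
    rw [← Real.rpow_add (by norm_num), show (4 : ℝ) = 2 ^ (2 : ℝ) by norm_num,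
      ← Real.rpow_mul (by norm_num)]
    refine Real.rpow_le_rpow_of_exponent_le (by norm_num) ?_
    nlinarith
  rcases le_total ((N : ℝ) / 2) d with h | h
  · set ε := ((N : ℝ) - d) / (2 * N) with hε
    have hεN : ε * N = (N - d) / 2 := by rw [hε]; field_simp
    have hε0 : 0 ≤ ε := div_nonneg (by linarith) (by linarith)
    have hε4 : ε ≤ 1 / 4 := by
      rw [hε, div_le_iff₀ (by linarith)]; linarith
    refine le_trans (mul_le_mul ?_ ?_ (by positivity) (by positivity)) (key ε ⟨hε0, hε4⟩)
    · exact card_filter_card_le_two_rpow (by linarith) (by linarith) (by rw [← hNdef]; linarith)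
    · refine card_filter_card_le_two_rpow (by linarith) (by linarith) ?_
      rw [← hNdef, Nat.cast_sub hd]; linarith
  · refine le_trans (mul_le_mul ?_ ?_ (by positivity) (by positivity))
      (key (1 / 4) ⟨by norm_num, le_rfl⟩)
    · exact card_filter_card_le_two_rpow (by norm_num) (by norm_num) (by rw [← hNdef]; linarith)
    · have : binEnt (2 * (1 / 4)) = 1 := by
        have : Real.log 2 ≠ 0 := (Real.log_pos (by norm_num)).ne'
        rw [binEnt_eq, show (2 : ℝ) * (1 / 4) = 2⁻¹ by norm_num, Real.binEntropy_two_inv,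
          div_self this]
      rw [this, mul_one, Real.rpow_natCast]
      have : #{S : Finset ι | #S ≤ N - d} ≤ 2 ^ N :=
        (card_le_univ _).trans (by rw [Fintype.card_finset])
      exact_mod_cast this

end Entropy

section Polynomial

variable {ι : Type*} [Fintype ι] [DecidableEq ι]

/-- A set of more than `#{T | #T < n - d}` points of the cube `𝔽₂ⁿ` supports a nonzero multilinear
polynomial function of degree at most `d`. -/
lemma exists_ne_zero_degree_le {d : ℕ} {D : Finset (ι → ZMod 2)}
    (hD : #{T : Finset ι | #T < Fintype.card ι - d} < #D) :
    ∃ (f : (ι → ZMod 2) → ZMod 2) (c : Finset ι → ZMod 2),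
      (∃ x ∈ D, f x ≠ 0) ∧ (∀ x ∉ D, f x = 0) ∧
      ∀ x, f x = ∑ S : Finset ι with #S ≤ d, c S * ∏ i ∈ S, x i := by
  let φ : (D → ZMod 2) →ₗ[ZMod 2]
      (({T : Finset ι | #T < Fintype.card ι - d} : Finset (Finset ι)) → ZMod 2) :=
    Matrix.mulVecLin (Matrix.of fun T y => ∏ i ∈ T.1, (1 + y.1 i))
  have hker : LinearMap.ker φ ≠ ⊥ := by
    apply LinearMap.ker_ne_bot_of_finrank_lt
    simpa only [Module.finrank_fintype_fun_eq_card, Fintype.card_coe] using hD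
  obtain ⟨g, hg, hg0⟩ := Submodule.exists_mem_ne_zero_of_ne_bot hker
  obtain ⟨x₀, hx₀⟩ := Function.ne_iff.1 hg0
  let f : (ι → ZMod 2) → ZMod 2 := fun x => if h : x ∈ D then g ⟨x, h⟩ else 0
  have hfg : ∀ x : D, f x = g x := fun x => by simp [f]
  have hf0 : ∀ x ∉ D, f x = 0 := fun x hx => by simp [f, hx]
  refine ⟨f, fun S => ∑ y, f y * ∏ i ∈ Sᶜ, (1 + y i), ⟨x₀, x₀.2, by rw [hfg]; exact hx₀⟩, hf0, ?_⟩
  have hvan : ∀ S : Finset ι, ¬ #S ≤ d → ∑ y, f y * ∏ i ∈ Sᶜ, (1 + y i) = 0 := by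
    intro S hS
    have hT : Sᶜ ∈ ({T : Finset ι | #T < Fintype.card ι - d} : Finset (Finset ι)) := by
      have := card_le_univ S
      simp only [mem_filter, mem_univ, true_and, card_compl]
      omega
    have h := congrFun (LinearMap.mem_ker.1 hg) ⟨Sᶜ, hT⟩
    rw [← sum_subset (subset_univ D) (fun y _ hy => by rw [hf0 y hy, zero_mul]), ← sum_coe_sort D]
    simpa [φ, Matrix.mulVec, dotProduct, hfg, mul_comm] using h
  intro x
  have hdelta : ∀ y : ι → ZMod 2, ∏ i, (x i + (1 + y i)) = if x = y then 1 else 0 := by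
    have key : ∀ a b : ZMod 2, a + (1 + b) = if a = b then 1 else 0 := by decide
    intro y
    simp only [key]
    split_ifs with h
    · simp [h]
    · obtain ⟨i, hi⟩ := Function.ne_iff.1 h
      exact prod_eq_zero (mem_univ i) (by simp [hi])
  have hprod : ∀ y : ι → ZMod 2, ∏ i, (x i + (1 + y i)) =
      ∑ S : Finset ι, (∏ i ∈ S, x i) * ∏ i ∈ Sᶜ, (1 + y i) := fun y => by
    rw [prod_add, powerset_univ]
    simp only [compl_eq_univ_sdiff]
  calc f x = ∑ y, f y * ∏ i, (x i + (1 + y i)) := by simp [hdelta]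
    _ = ∑ S : Finset ι, (∑ y, f y * ∏ i ∈ Sᶜ, (1 + y i)) * ∏ i ∈ S, x i := by
        simp only [hprod, mul_sum, sum_mul]
        rw [sum_comm]
        exact sum_congr rfl fun S _ => sum_congr rfl fun y _ =>
          (mul_assoc _ _ _).symm.trans (mul_right_comm _ _ _)
    _ = _ := by
        rw [sum_filter]
        refine sum_congr rfl fun S _ => ?_
        split_ifs with h
        · rfl
        · rw [hvan S h, zero_mul]

/-- The Croot–Lev–Pach lemma. -/
lemma eq_zero_of_degree_le {d : ℕ} {f : (ι → ZMod 2) → ZMod 2} {c : Finset ι → ZMod 2}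
    (hf : ∀ x, f x = ∑ S : Finset ι with #S ≤ d, c S * ∏ i ∈ S, x i)
    {K : Finset (ι → ZMod 2)} (hK : 2 * #{S : Finset ι | #S ≤ d / 2} < #K) (w : ι → ZMod 2)
    (h : ∀ a ∈ K, ∀ b ∈ K, a ≠ b → f (a + b + w) = 0) : f w = 0 := by
  by_contra hw
  let L := ({S : Finset ι | #S ≤ d / 2} : Finset (Finset ι))
  let m : (ι → ZMod 2) → Finset ι → ZMod 2 := fun x S => ∏ i ∈ S, x i
  let C : Finset ι → Finset ι → ZMod 2 := fun T U =>
    if Disjoint T U ∧ #(T ∪ U) ≤ d then c (T ∪ U) else 0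
  have hexp : ∀ x y, f (x + y) = ∑ T, ∑ U, C T U * (m x T * m y U) := by
    intro x y
    rw [hf, sum_filter]
    simp only [Pi.add_apply, prod_add, mul_sum]
    have hS : ∀ S : Finset ι, (if #S ≤ d then
        ∑ T ∈ S.powerset, c S * ((∏ i ∈ T, x i) * ∏ i ∈ S \ T, y i) else 0) =
        ∑ T, if T ⊆ S then (if #S ≤ d then c S * (m x T * m y (S \ T)) else 0) else 0 := by
      intro S
      rw [← sum_filter]
      split_ifs
      · exact sum_congr (by ext T; simp) fun _ _ => rfl
      · simp
    simp only [hS]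
    rw [sum_comm]
    refine sum_congr rfl fun T _ => ?_
    have hU : ∀ U, C T U * (m x T * m y U) = if Disjoint T U then
        (if #(T ∪ U) ≤ d then c (T ∪ U) * (m x T * m y U) else 0) else 0 := by
      intro U
      simp only [C, ite_and]
      split_ifs <;> simp
    simp only [hU]
    rw [← sum_filter (fun S => T ⊆ S), ← sum_filter (fun U => Disjoint T U)]
    refine sum_bij' (fun S _ => S \ T) (fun U _ => T ∪ U) ?_ ?_ ?_ ?_ ?_
    · intro S _
      simpa using disjoint_sdiff
    · intro U _
      simp
    · intro S hS
      exact union_sdiff_of_subset (by simpa using hS)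
    · intro U hU
      exact union_sdiff_cancel_left (by simpa using hU)
    · intro S hS
      simp only [union_sdiff_of_subset (show T ⊆ S by simpa using hS)]
  have hC : ∀ T U, T ∉ L → U ∉ L → C T U = 0 := by
    intro T U hT hU
    simp only [L, mem_filter, mem_univ, true_and, not_le] at hT hU
    refine if_neg fun h => ?_
    have := card_union_of_disjoint h.1
    omega
  let P : Matrix K (L ⊕ L) (ZMod 2) := Matrix.of fun a => Sum.elim (fun T => m a T)
    (fun U => ∑ T with T ∉ L, C T U * m a T)
  let Q : Matrix (L ⊕ L) K (ZMod 2) := Matrix.of fun s b => Sum.elim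
    (fun T : L => ∑ U, C T U * m (b + w) U) (fun U : L => m (b + w) U) s
  have hPQ : P * Q = f w • (1 : Matrix K K (ZMod 2)) := by
    ext a b
    have h1 : (P * Q) a b = f (a + b + w) := by
      rw [add_assoc, hexp, ← sum_filter_add_sum_filter_not univ (· ∈ L), filter_univ_mem]
      simp only [Matrix.mul_apply, P, Q, Matrix.of_apply, Fintype.sum_sum_type, Sum.elim_inl,
        Sum.elim_inr]
      rw [sum_coe_sort L fun T => m a T * ∑ U, C T U * m (b + w) U,
        sum_coe_sort L fun U => (∑ T with T ∉ L, C T U * m a T) * m (b + w) U]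
      congr 1
      · simp only [mul_sum]
        exact sum_congr rfl fun T _ => sum_congr rfl fun U _ => mul_left_comm _ _ _
      · simp only [sum_mul, mul_assoc]
        rw [sum_comm]
        refine sum_congr rfl fun T hT => sum_subset (subset_univ L) fun U _ hU => ?_
        rw [hC T U (mem_filter.1 hT).2 hU, zero_mul]
    rw [h1]
    by_cases hab : a = b
    · subst hab
      have : (a : ι → ZMod 2) + a = 0 := funext fun i => CharTwo.add_self_eq_zero _
      simp [this]
    · rw [h a a.2 b b.2 (fun h => hab (Subtype.ext h))]
      simp [hab]
  have hrank : (P * Q).rank = #K := by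
    rw [hPQ, Matrix.rank_of_isUnit, Fintype.card_coe]
    exact (isUnit_one).smul (Units.mk0 _ hw)
  have := (Matrix.rank_mul_le_left P Q).trans P.rank_le_card_width
  rw [hrank] at this
  simp only [Fintype.card_sum, Fintype.card_coe, L] at this
  omega

lemma card_le_of_large_fibers {d : ℕ} {D : Finset (ι → ZMod 2)}
    (K : (ι → ZMod 2) → Finset (ι → ZMod 2))
    (hK : ∀ r ∈ D, 2 * #{S : Finset ι | #S ≤ d / 2} < #(K r))
    (h : ∀ r ∈ D, ∀ a ∈ K r, ∀ b ∈ K r, a ≠ b → a + b + r ∉ D) :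
    #D ≤ #{T : Finset ι | #T < Fintype.card ι - d} := by
  by_contra! hD
  obtain ⟨f, c, ⟨x, hx, hfx⟩, hf0, hf⟩ := exists_ne_zero_degree_le hD
  exact hfx (eq_zero_of_degree_le hf (hK x hx) x fun a ha b hb hab => hf0 _ (h x hx a ha b hb hab))

end Polynomial

section ZModFour

variable {ι : Type*}

/-- The reduction modulo `2` of a vector over `ℤ/4ℤ`. -/
def lowBits (x : ι → ZMod 4) : ι → ZMod 2 := fun i => ((x i).val : ZMod 2)

/-- The vector of the leading binary digits of the entries of a vector over `ℤ/4ℤ`. -/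
def highBits (x : ι → ZMod 4) : ι → ZMod 2 := fun i => ((x i).val / 2 : ℕ)

lemma eq_of_lowBits_eq_of_highBits_eq {x y : ι → ZMod 4} (hl : lowBits x = lowBits y)
    (hh : highBits x = highBits y) : x = y := by
  have key : ∀ a b : ZMod 4, (a.val : ZMod 2) = b.val →
      ((a.val / 2 : ℕ) : ZMod 2) = (b.val / 2 : ℕ) → a = b := by decide
  exact funext fun i => key _ _ (congrFun hl i) (congrFun hh i)

lemma add_eq_add_self_of_bits {a b c : ι → ZMod 4} (hab : lowBits a = lowBits b)
    (h : highBits a + highBits b + lowBits a = lowBits c) : a + b = c + c := by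
  have key : ∀ a b c : ZMod 4, (a.val : ZMod 2) = b.val →
      ((a.val / 2 : ℕ) : ZMod 2) + (b.val / 2 : ℕ) + a.val = c.val → a + b = c + c := by decide
  exact funext fun i => key _ _ _ (congrFun hab i) (congrFun h i)

lemma card_le_mul_rpow_gam [Fintype ι] [DecidableEq ι] [Nonempty ι] {A : Finset (ι → ZMod 4)}
    (hA : ∀ a ∈ A, ∀ b ∈ A, ∀ c ∈ A, a + b = c + c → a = b) :
    (#A : ℝ) ≤ 2 * (Fintype.card ι + 1) * (4 : ℝ) ^ (gam * Fintype.card ι) := by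
  set N := Fintype.card ι with hN
  let F : (ι → ZMod 2) → Finset (ι → ZMod 4) := fun r => {a ∈ A | lowBits a = r}
  let B : ℕ → ℕ := fun m => #{S : Finset ι | #S ≤ m}
  let D : ℕ → Finset (ι → ZMod 2) := fun d => {r | 2 * B (d / 2) < #(F r)}
  have hKcard : ∀ r, #((F r).image highBits) = #(F r) := fun r =>
    card_image_of_injOn fun x hx y hy hxy => by
      simp only [F, coe_filter, Set.mem_ofPred_eq] at hx hy
      exact eq_of_lowBits_eq_of_highBits_eq (hx.2.trans hy.2.symm) hxy
  have hD : ∀ d, #(D d) ≤ #{T : Finset ι | #T < N - d} := by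
    intro d
    refine card_le_of_large_fibers (fun r => (F r).image highBits) ?_ ?_
    · intro r hr
      simp only [hKcard]
      exact (mem_filter.1 hr).2
    · intro r hr x hx y hy hxy hD'
      obtain ⟨a, ha, rfl⟩ := mem_image.1 hx
      obtain ⟨b, hb, rfl⟩ := mem_image.1 hy
      have ha' := mem_filter.1 ha
      have hb' := mem_filter.1 hb
      have hpos : 0 < #(F (highBits a + highBits b + r)) :=
        lt_of_le_of_lt (Nat.zero_le _) (mem_filter.1 hD').2
      obtain ⟨c, hc⟩ := card_pos.1 hpos
      have hc' := mem_filter.1 hc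
      refine hxy (congrArg highBits (hA a ha'.1 b hb'.1 c hc'.1 ?_))
      exact add_eq_add_self_of_bits (ha'.2.trans hb'.2.symm) (by rw [hc'.2, ha'.2])
  let E : ℕ → Finset (ι → ZMod 2) := fun
    | 0 => univ
    | e + 1 => D e
  have hE : ∀ d ≤ N, #(E d) ≤ B (N - d) := by
    intro d hd
    cases d with
    | zero =>
      refine (card_le_univ _).trans ?_
      have : B (N - 0) = 2 ^ N := by
        have : ({S : Finset ι | #S ≤ N} : Finset (Finset ι)) = univ := by
          ext S; simpa using card_le_univ S
        rw [show B (N - 0) = #(univ : Finset (Finset ι)) from congrArg card this, card_univ,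
          Fintype.card_finset]
      rw [this]
      simp [hN]
    | succ e =>
      refine (hD e).trans (card_le_card fun T hT => ?_)
      simp only [mem_filter, mem_univ, true_and] at hT ⊢
      omega
  have hF : ∀ r : ι → ZMod 2, #(F r) ≤
      ∑ d ∈ range (N + 1), if r ∈ E d then 2 * B (d / 2) else 0 := by
    intro r
    have hex : ∃ d, r ∉ D d ∧ d ≤ N := by
      refine ⟨N, fun hr => ?_, le_rfl⟩
      have h0 := hD N
      simp only [Nat.sub_self, not_lt_zero, filter_false, card_empty, Nat.le_zero,
        card_eq_zero] at h0
      simp [h0] at hr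
    classical
    obtain ⟨d, hd, hmin⟩ : ∃ d, (r ∉ D d ∧ d ≤ N) ∧ ∀ e < d, ¬ (r ∉ D e ∧ e ≤ N) :=
      ⟨Nat.find hex, Nat.find_spec hex, fun e he => Nat.find_min hex he⟩
    have hmem : r ∈ E d := by
      cases d with
      | zero => exact mem_univ r
      | succ e =>
        by_contra hre
        exact hmin e (Nat.lt_succ_self e) ⟨hre, (Nat.le_succ e).trans hd.2⟩
    have hle : #(F r) ≤ 2 * B (d / 2) := by
      simpa [D] using hd.1
    refine hle.trans ?_
    refine le_trans (by rw [if_pos hmem]) (single_le_sum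
      (f := fun d => if r ∈ E d then 2 * B (d / 2) else 0) (fun _ _ => Nat.zero_le _)
      (mem_range.2 (Nat.lt_succ_of_le hd.2)))
  have hsum : #A ≤ ∑ d ∈ range (N + 1), 2 * (B (d / 2) * B (N - d)) := by
    calc #A = ∑ r, #(F r) := card_eq_sum_card_fiberwise fun _ _ => mem_univ _
      _ ≤ ∑ r, ∑ d ∈ range (N + 1), if r ∈ E d then 2 * B (d / 2) else 0 :=
        sum_le_sum fun r _ => hF r
      _ = ∑ d ∈ range (N + 1), #(E d) * (2 * B (d / 2)) := by
        rw [sum_comm]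
        simp
      _ ≤ _ := by
        refine sum_le_sum fun d hd => ?_
        have := hE d (by simpa [Nat.lt_succ_iff] using hd)
        calc _ ≤ B (N - d) * (2 * B (d / 2)) := Nat.mul_le_mul_right _ this
          _ = _ := by ring
  calc (#A : ℝ) ≤ ∑ d ∈ range (N + 1), 2 * ((B (d / 2) : ℝ) * B (N - d)) := by
        exact_mod_cast hsum
    _ ≤ ∑ d ∈ range (N + 1), 2 * (4 : ℝ) ^ (gam * N) := by
        refine sum_le_sum fun d hd => ?_
        have := card_mul_card_le_rpow_gam (ι := ι) (d := d) (by simpa [Nat.lt_succ_iff] using hd)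
        exact mul_le_mul_of_nonneg_left this (by norm_num)
    _ = _ := by
        simp
        ring

end ZModFour

lemma le_of_pow_le_linear_mul_pow {x y a b : ℝ} (hy : 0 < y)
    (h : ∀ k : ℕ, 1 ≤ k → x ^ k ≤ (a * k + b) * y ^ k) : x ≤ y := by
  by_contra! hxy
  set q := x / y with hq
  have hq1 : 1 < q := by rwa [hq, one_lt_div hy]
  have hle : ∀ k : ℕ, 1 ≤ k → 1 ≤ a * (k / q ^ k) + b * (1 / q ^ k) := by
    intro k hk
    have hqk : 0 < q ^ k := by positivity
    have := h k hk
    rw [← div_le_iff₀ (by positivity), ← div_pow, ← hq] at this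
    rw [← mul_div_assoc, ← mul_div_assoc, ← add_div, le_div_iff₀ hqk]
    linarith
  have h1 := tendsto_pow_const_div_const_pow_of_one_lt 1 hq1
  have h0 := tendsto_pow_const_div_const_pow_of_one_lt 0 hq1
  have hlim := (h1.const_mul a).add (h0.const_mul b)
  simp only [pow_one, pow_zero, mul_zero, add_zero] at hlim
  have := ge_of_tendsto hlim (Filter.eventually_atTop.2 ⟨1, hle⟩)
  norm_num at this

theorem progressionFree_card_le (n : ℕ) (hn : 1 ≤ n)
    (A : Finset (Fin n → ZMod 4)) (hA : ProgressionFree (A : Set (Fin n → ZMod 4))) :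
    (A.card : ℝ) ≤ (4 : ℝ) ^ (gam * n) := by
  have hA' : ∀ a ∈ A, ∀ b ∈ A, ∀ c ∈ A, a + b = c + c → a = b := by
    intro a ha b hb c hc h
    by_contra hab
    refine hA ⟨a, ha, b, hb, c, hc, hab, ?_, ?_, h⟩
    · rintro rfl
      exact hab (add_left_cancel h).symm
    · rintro rfl
      exact hab (add_right_cancel h)
  refine le_of_pow_le_linear_mul_pow (a := 2 * n) (b := 2) (by positivity) fun k hk => ?_
  have : Nonempty (Fin k × Fin n) := ⟨⟨0, hk⟩, ⟨0, hn⟩⟩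
  let e : (Fin k → Fin n → ZMod 4) ≃ (Fin k × Fin n → ZMod 4) := (Equiv.curry _ _ _).symm
  have h := card_le_mul_rpow_gam (A := (Fintype.piFinset fun _ : Fin k => A).map e.toEmbedding) ?_
  · rw [card_map, Fintype.card_piFinset_const] at h
    simp only [Fintype.card_prod, Fintype.card_fin, Nat.cast_pow, Nat.cast_mul] at h
    refine h.trans_eq ?_
    rw [← Real.rpow_mul_natCast (by norm_num)]
    ring_nf
  · simp only [mem_map_equiv, Fintype.mem_piFinset]
    intro a ha b hb c hc habc
    refine e.symm.injective (funext fun i => hA' _ (ha i) _ (hb i) _ (hc i) ?_)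
    exact funext fun j => congrFun habc (i, j)
end

section
/- Let n ≥ 1 and let A ⊆ (ℤ/4ℤ)^n be progression-free. If a, a' ∈ A are distinct elements lying in a common coset of F_n, and r ∈ (ℤ/4ℤ)^n is any element whose F_n-coset r + F_n contains at least one element of A, then a + a' ≠ 2r. -/
/-- `F_n = {g ∈ (ℤ/4ℤ)^n : 2g = 0}`, the subgroup of `(ℤ/4ℤ)^n` generated by its
involutions. -/
def Fsub (n : ℕ) : AddSubgroup (Fin n → ZMod 4) where
  carrier := {g | g + g = 0}
  add_mem' := by
    intro a b ha hb
    simp only [Set.mem_setOf_eq] at *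
    calc a + b + (a + b) = (a + a) + (b + b) := by abel
    _ = 0 := by rw [ha, hb, add_zero]
  zero_mem' := by simp
  neg_mem' := by
    intro a ha
    simp only [Set.mem_setOf_eq] at *
    rw [← neg_add, ha, neg_zero]

theorem doubled_sums_avoid_doubled_reps (n : ℕ) (hn : 1 ≤ n)
    (A : Set (Fin n → ZMod 4)) (hA : ProgressionFree A)
    (a a' : Fin n → ZMod 4) (ha : a ∈ A) (ha' : a' ∈ A) (hne : a ≠ a')
    (hcoset : a - a' ∈ Fsub n)
    (r : Fin n → ZMod 4) (hr : ∃ b ∈ A, b - r ∈ Fsub n) :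
    a + a' ≠ r + r := by
  intro h
  obtain ⟨b, hb, hbr⟩ := hr
  have hbr : b - r + (b - r) = 0 := hbr
  have hbb : b + b = r + r := by
    rw [← sub_eq_zero, ← hbr]
    abel
  have hab : a + a' = b + b := h.trans hbb.symm
  refine hA ⟨a, ha, a', ha', b, hb, hne, ?_, ?_, hab⟩
  · rintro rfl
    exact hne (add_left_cancel hab).symm
  · rintro rfl
    exact hne (add_right_cancel hab)
end
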